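/- arXiv:2005.13468 — 5 statements merged into one kernel-verified Lean document; each statement's English description precedes it below -/
import Mathlib

section
/- For every ρ ∈ (0, 1) there exists a constant C > 0 such that for all t > 0, |E_{ρ,ρ}(−t)| ≤ C/(1 + t). -/
open Filter Topology PowerSeries Finset

theorem multichoose_succ_right (a : ℝ) (n : ℕ) :
    (n + 1) * Ring.multichoose a (n + 1) = (a + n) * Ring.multichoose a n := by
  have h1 := Ring.factorial_nsmul_multichoose_eq_ascPochhammer a (n + 1)
  have h0 := Ring.factorial_nsmul_multichoose_eq_ascPochhammer a n
  rw [Polynomial.ascPochhammer_smeval_eq_eval, nsmul_eq_mul] at h0 h1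
  rw [ascPochhammer_succ_eval, ← h0, Nat.factorial_succ] at h1
  push_cast at h1
  have : (n.factorial : ℝ) ≠ 0 := by positivity
  apply mul_left_cancel₀ this
  linear_combination h1

theorem multichoose_succ_left (a : ℝ) (n : ℕ) :
    (n + 1) * Ring.multichoose a (n + 1) = a * Ring.multichoose (a + 1) n := by
  induction n with
  | zero => simp
  | succ n ih =>
    have h := multichoose_succ_right a (n + 1)
    have h' := multichoose_succ_right (a + 1) n
    have : (n + 1 : ℝ) ≠ 0 := by positivity
    apply mul_left_cancel₀ this
    push_cast at h ⊢
    linear_combination (n + 1 : ℝ) * h + (a + n + 1) * ih - a * h'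

theorem multichoose_nonneg {a : ℝ} (ha : 0 ≤ a) (n : ℕ) : 0 ≤ Ring.multichoose a n := by
  induction n with
  | zero => simp
  | succ n ih =>
    have h := multichoose_succ_right a n
    have : (0 : ℝ) < n + 1 := by positivity
    refine nonneg_of_mul_nonneg_right (?_ : 0 ≤ (n + 1 : ℝ) * _) this
    rw [h]; positivity

theorem multichoose_succ_nonpos {a : ℝ} (ha : a ≤ 0) (ha' : -1 ≤ a) (n : ℕ) :
    Ring.multichoose a (n + 1) ≤ 0 := by
  have h := multichoose_succ_left a n
  have := multichoose_nonneg (a := a + 1) (by linarith) n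
  nlinarith [mul_nonneg (neg_nonneg.2 ha) this]

theorem sum_range_multichoose (a : ℝ) (n : ℕ) :
    ∑ j ∈ range (n + 1), Ring.multichoose a j = Ring.multichoose (a + 1) n := by
  induction n with
  | zero => simp
  | succ n ih => rw [sum_range_succ, ih, Ring.multichoose_succ_succ, add_comm]

theorem hasSum_multichoose_mul_pow (a : ℝ) {r : ℝ} (hr0 : 0 ≤ r) (hr1 : r < 1) :
    HasSum (fun n ↦ Ring.multichoose a n * r ^ n) ((1 - r) ^ (-a)) := by
  have h := (Real.one_div_one_sub_rpow_hasFPowerSeriesOnBall_zero a).hasSum (y := r) (by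
    simp [abs_of_nonneg hr0, hr1, ← NNReal.coe_lt_coe, enorm_eq_nnnorm])
  simpa [FormalMultilinearSeries.ofScalars_apply_eq, ← Ring.multichoose_eq, mul_comm,
    Real.rpow_neg (sub_nonneg.2 hr1.le)] using h

/-- The power series of `(1 - X) ^ (-a)`. -/
noncomputable def multichooseSeries (a : ℝ) : ℝ⟦X⟧ := PowerSeries.mk (Ring.multichoose a)

@[simp]
theorem coeff_multichooseSeries (a : ℝ) (n : ℕ) :
    coeff n (multichooseSeries a) = Ring.multichoose a n := coeff_mk _ _

theorem multichooseSeries_eq_rescale (a : ℝ) :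
    multichooseSeries a = rescale (-1) (PowerSeries.binomialSeries ℝ (-a)) := by
  ext n
  have h : (Int.negOnePow n : ℤˣ) • Ring.multichoose a n = (-1) ^ n * Ring.multichoose a n := by
    simp [Units.smul_def, Int.negOnePow]
  rw [coeff_rescale, binomialSeries_coeff, Ring.choose_neg', coeff_multichooseSeries, h,
    smul_eq_mul, mul_one, ← mul_assoc, ← mul_pow]
  simp

theorem multichooseSeries_add (a b : ℝ) :
    multichooseSeries (a + b) = multichooseSeries a * multichooseSeries b := by
  simp only [multichooseSeries_eq_rescale, neg_add, binomialSeries_add, map_mul]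

theorem multichooseSeries_zero : multichooseSeries 0 = 1 := by
  simp [multichooseSeries_eq_rescale]

theorem derivative_multichooseSeries (a : ℝ) :
    d⁄dX ℝ (multichooseSeries a) = C a * multichooseSeries (a + 1) := by
  ext n
  rw [coeff_derivative, coeff_C_mul, coeff_multichooseSeries, coeff_multichooseSeries,
    ← multichoose_succ_left, mul_comm]

theorem coeff_multichooseSeries_one_mul (f : ℝ⟦X⟧) (n : ℕ) :
    coeff n (multichooseSeries 1 * f) = ∑ j ∈ range (n + 1), coeff j f := by
  rw [mul_comm, coeff_mul, Nat.sum_antidiagonal_eq_sum_range_succ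
    (fun i j ↦ coeff i f * coeff j (multichooseSeries 1))]
  simp [Ring.multichoose_one]

theorem coeff_mul_nonneg {f g : ℝ⟦X⟧} (hf : ∀ n, 0 ≤ coeff n f) (hg : ∀ n, 0 ≤ coeff n g)
    (n : ℕ) : 0 ≤ coeff n (f * g) := by
  rw [coeff_mul]
  exact sum_nonneg fun p _ ↦ mul_nonneg (hf _) (hg _)

section Resolvent

variable {ρ c : ℝ} {u : ℝ⟦X⟧}

theorem resolvent_coeff_nonneg (hρ0 : 0 ≤ ρ) (hρ1 : ρ ≤ 1) (hc : 0 ≤ c)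
    (hu : (multichooseSeries (-ρ) + C c) * u = 1) (n : ℕ) : 0 ≤ coeff n u := by
  induction n using Nat.strong_induction_on with
  | _ n ih =>
  have h := congrArg (coeff n) hu
  rw [add_mul, map_add, coeff_C_mul, coeff_mul, Nat.sum_antidiagonal_eq_sum_range_succ
    (fun i j ↦ coeff i (multichooseSeries (-ρ)) * coeff j u), sum_range_succ'] at h
  simp only [coeff_multichooseSeries, Ring.multichoose_zero_right, one_mul, Nat.sub_zero] at h
  have h1 : ∑ k ∈ range n, Ring.multichoose (-ρ) (k + 1) * coeff (n - (k + 1)) u ≤ 0 :=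
    sum_nonpos fun k hk ↦ mul_nonpos_of_nonpos_of_nonneg
      (multichoose_succ_nonpos (by linarith) (by linarith) k) (ih _ (by grind))
  have h2 : 0 ≤ coeff n (1 : ℝ⟦X⟧) := by
    rw [coeff_one]; split_ifs <;> norm_num
  by_contra! h3
  nlinarith [mul_nonneg hc (neg_nonneg.2 h3.le)]

theorem resolvent_coeff_le (hρ0 : 0 ≤ ρ) (hρ1 : ρ ≤ 1) (hc : 0 ≤ c)
    (hu : (multichooseSeries (-ρ) + C c) * u = 1) (n : ℕ) :
    coeff n u ≤ Ring.multichoose ρ n := by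
  have hP : multichooseSeries ρ * multichooseSeries (-ρ) = 1 := by
    rw [← multichooseSeries_add, add_neg_cancel, multichooseSeries_zero]
  have h : u = multichooseSeries ρ - C c * (multichooseSeries ρ * u) := by
    linear_combination multichooseSeries ρ * hu - u * hP
  have h' := congrArg (coeff n) h
  rw [map_sub, coeff_C_mul, coeff_multichooseSeries] at h'
  have := coeff_mul_nonneg (f := multichooseSeries ρ) (g := u)
    (fun n ↦ by simpa using multichoose_nonneg hρ0 n)
    (resolvent_coeff_nonneg hρ0 hρ1 hc hu) n
  nlinarith [mul_nonneg hc this]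

theorem mul_resolvent_coeff_le (hρ0 : 0 ≤ ρ) (hρ1 : ρ ≤ 1) (hc : 0 ≤ c)
    (hu : (multichooseSeries (-ρ) + C c) * u = 1) (n : ℕ) :
    c * (n * coeff n u) ≤ ρ := by
  have hu0 := resolvent_coeff_nonneg hρ0 hρ1 hc hu
  set T := multichooseSeries (1 - ρ) * u with hT
  have hT' : T = multichooseSeries 1 * (1 - C c * u) := by
    rw [hT, sub_eq_add_neg, multichooseSeries_add]
    linear_combination multichooseSeries 1 * hu
  have hTn (n : ℕ) : coeff n T = 1 - c * ∑ j ∈ range (n + 1), coeff j u := by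
    rw [hT', coeff_multichooseSeries_one_mul]
    simp [coeff_one, sum_range_succ', mul_sum, mul_add]
  have hT0 : ∀ n, 0 ≤ coeff n T :=
    coeff_mul_nonneg (fun n ↦ by simpa using multichoose_nonneg (by linarith) n) hu0
  have hT1 (n : ℕ) : coeff n T ≤ 1 := by
    rw [hTn]
    nlinarith [mul_nonneg hc (sum_nonneg fun j (_ : j ∈ range (n + 1)) ↦ hu0 j)]
  have hd : d⁄dX ℝ u = C ρ * (u * T) := by
    have h := congrArg (d⁄dX ℝ) hu
    simp only [Derivation.leibniz, map_add, derivative_multichooseSeries, derivative_C,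
      smul_eq_mul, add_zero, Derivation.map_one_eq_zero, map_neg, neg_add_eq_sub] at h
    rw [hT]
    linear_combination u * h - d⁄dX ℝ u * hu
  cases n with
  | zero => simpa using hρ0
  | succ n =>
    have h := congrArg (coeff n) hd
    rw [coeff_derivative, coeff_C_mul, coeff_mul, Nat.sum_antidiagonal_eq_sum_range_succ
      (fun i j ↦ coeff i u * coeff j T)] at h
    have h1 : ∑ k ∈ range (n + 1), coeff k u * coeff (n - k) T ≤ ∑ k ∈ range (n + 1), coeff k u :=
      sum_le_sum fun k _ ↦ mul_le_of_le_one_right (hu0 k) (hT1 _)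
    have h2 := hT0 n
    rw [hTn] at h2
    push_cast
    calc c * ((n + 1) * coeff (n + 1) u)
        = ρ * (c * ∑ k ∈ range (n + 1), coeff k u * coeff (n - k) T) := by
          linear_combination c * h
      _ ≤ ρ * (c * ∑ k ∈ range (n + 1), coeff k u) := by gcongr
      _ ≤ ρ := mul_le_of_le_one_right hρ0 (by linarith)

end Resolvent

theorem multichoose_mul_pow_le {a r : ℝ} (ha : 0 ≤ a) (hr0 : 0 < r) (hr1 : r < 1) (n : ℕ) :
    Ring.multichoose a n * r ^ n ≤ (1 - r) ^ (-a) :=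
  (hasSum_multichoose_mul_pow a hr0.le hr1).summable.le_tsum n
    (fun j _ ↦ mul_nonneg (multichoose_nonneg ha j) (by positivity)) |>.trans_eq
    (hasSum_multichoose_mul_pow a hr0.le hr1).tsum_eq

theorem natCast_mul_multichoose_mul_pow_le {a r : ℝ} (ha : 0 ≤ a) (hr0 : 0 < r) (hr1 : r < 1)
    (n : ℕ) : n * Ring.multichoose a n * r ^ n ≤ a * (1 - r) ^ (-a) := by
  cases n with
  | zero => simpa using mul_nonneg ha (Real.rpow_nonneg (by linarith) _)
  | succ n =>
    push_cast
    rw [multichoose_succ_left, ← sum_range_multichoose, mul_assoc, sum_mul]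
    refine mul_le_mul_of_nonneg_left ?_ ha
    have hs := hasSum_multichoose_mul_pow a hr0.le hr1
    refine le_trans (sum_le_sum fun j hj ↦ ?_) (sum_le_hasSum (range (n + 1))
      (fun j _ ↦ mul_nonneg (multichoose_nonneg ha j) (by positivity)) hs)
    exact mul_le_mul_of_nonneg_left
      (pow_le_pow_of_le_one hr0.le hr1.le (by grind)) (multichoose_nonneg ha j)

theorem rpow_neg_mul_natCast_add {y : ℝ} (hy : 0 < y) (ρ : ℝ) (k : ℕ) :
    y ^ (-(ρ * k + ρ)) = ((y ^ ρ) ^ (k + 1))⁻¹ := by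
  rw [Real.rpow_neg hy.le, ← Real.rpow_mul_natCast hy.le]
  push_cast
  ring_nf

theorem summable_neg_pow_mul_multichoose {ρ c : ℝ} (hρ : 0 < ρ) (hc : 0 < c)
    (hc' : 2 * c < 1) (n : ℕ) :
    Summable fun k : ℕ ↦ (-c) ^ k * Ring.multichoose (ρ * k + ρ) n := by
  set y := (2 * c) ^ ρ⁻¹ with hy
  have hy0 : 0 < y := by positivity
  have hy1 : y < 1 := Real.rpow_lt_one (by positivity) hc' (by positivity)
  have hyρ : y ^ ρ = 2 * c := by rw [hy, Real.rpow_inv_rpow (by positivity) hρ.ne']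
  refine Summable.of_norm_bounded
    (g := fun k : ℕ ↦ ((1 - y) ^ n)⁻¹ * (2 * c)⁻¹ * (1 / 2) ^ k)
    (summable_geometric_two.mul_left _) fun k ↦ ?_
  have ha : 0 ≤ ρ * k + ρ := by positivity
  have h := multichoose_mul_pow_le ha (sub_pos.2 hy1) (sub_lt_self 1 hy0) n
  rw [sub_sub_cancel, rpow_neg_mul_natCast_add hy0, hyρ] at h
  have hr : 0 < (1 - y) ^ n := pow_pos (sub_pos.2 hy1) n
  rw [norm_mul, norm_pow, norm_neg, Real.norm_of_nonneg hc.le,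
    Real.norm_of_nonneg (multichoose_nonneg ha n)]
  calc c ^ k * Ring.multichoose (ρ * k + ρ) n
      ≤ c ^ k * (((2 * c) ^ (k + 1))⁻¹ / (1 - y) ^ n) := by gcongr; rwa [le_div_iff₀ hr]
    _ = _ := by rw [one_div, inv_pow, mul_pow]; field_simp; ring

/-- The power series of `((1 - X) ^ ρ + c)⁻¹`, expanded in powers of `c`. -/
noncomputable def resolventSeries (ρ c : ℝ) : ℝ⟦X⟧ :=
  PowerSeries.mk fun n ↦ ∑' k : ℕ, (-c) ^ k * Ring.multichoose (ρ * k + ρ) n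

theorem mul_resolventSeries {ρ c : ℝ} (hρ : 0 < ρ) (hc : 0 < c) (hc' : 2 * c < 1) :
    (multichooseSeries (-ρ) + C c) * resolventSeries ρ c = 1 := by
  ext n
  have hs (j : ℕ) : HasSum (fun k : ℕ ↦ (-c) ^ k * Ring.multichoose (ρ * k + ρ) j)
      (coeff j (resolventSeries ρ c)) := by
    rw [resolventSeries, coeff_mk]
    exact (summable_neg_pow_mul_multichoose hρ hc hc' j).hasSum
  have h1 : HasSum (fun k : ℕ ↦ (-c) ^ k * Ring.multichoose (ρ * k) n)
      (coeff n (multichooseSeries (-ρ) * resolventSeries ρ c)) := by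
    rw [coeff_mul]
    refine (hasSum_sum fun p (_ : p ∈ antidiagonal n) ↦
      (hs p.2).mul_left (coeff p.1 (multichooseSeries (-ρ)))).congr_fun fun k ↦ ?_
    rw [show ρ * k = -ρ + (ρ * k + ρ) by ring, ← coeff_multichooseSeries, multichooseSeries_add,
      coeff_mul, mul_sum]
    simp [mul_left_comm]
  have h2 := (hasSum_nat_add_iff' 1).2 h1
  have h3 := h2.unique (((hs n).mul_left (-c)).congr_fun ?_)
  · rw [add_mul, map_add, coeff_C_mul]
    simp only [range_one, sum_singleton, Nat.cast_zero, mul_zero, pow_zero, one_mul,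
      ← coeff_multichooseSeries, multichooseSeries_zero] at h3
    linarith
  · intro k
    push_cast
    ring_nf

theorem tendsto_rpow_mul_multichoose {a : ℝ} (ha : 0 < a) :
    Tendsto (fun n : ℕ ↦ (n : ℝ) ^ (1 - a) * Ring.multichoose a n) atTop
      (𝓝 (Real.Gamma a)⁻¹) := by
  have hprod (n : ℕ) : n.factorial * Ring.multichoose a n = ∏ j ∈ range n, (a + j) := by
    induction n with
    | zero => simp
    | succ n ih =>
      rw [prod_range_succ, ← ih, Nat.factorial_succ]
      push_cast
      linear_combination (n.factorial : ℝ) * multichoose_succ_right a n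
  have h1 : Tendsto (fun n : ℕ ↦ (n : ℝ) / (n + a)) atTop (𝓝 1) :=
    tendsto_natCast_div_add_atTop a
  have h2 := h1.mul ((Real.GammaSeq_tendsto_Gamma a).inv₀ (Real.Gamma_pos_of_pos ha).ne')
  rw [one_mul] at h2
  refine h2.congr' ?_
  filter_upwards [eventually_gt_atTop 0] with n hn
  have hn' : (0 : ℝ) < n := by exact_mod_cast hn
  have hf : (0 : ℝ) < n.factorial := by positivity
  rw [Real.GammaSeq, prod_range_succ, ← hprod, Real.rpow_sub hn', Real.rpow_one]
  have : (0 : ℝ) < (n : ℝ) ^ a := by positivity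
  field_simp
  ring

theorem tendsto_rpow_mul_coeff_resolventSeries {ρ t : ℝ} (hρ : 0 < ρ) (ht : 0 < t) :
    Tendsto (fun n : ℕ ↦ (n : ℝ) ^ (1 - ρ) * coeff n (resolventSeries ρ (t * (n : ℝ) ^ (-ρ))))
      atTop (𝓝 (∑' k : ℕ, (-t) ^ k / Real.Gamma (ρ * k + ρ))) := by
  set m := (2 * t) ^ ρ⁻¹ with hm
  have hm0 : 0 < m := by positivity
  have hmρ : m ^ ρ = 2 * t := by rw [hm, Real.rpow_inv_rpow (by positivity) hρ.ne']
  have key : Tendsto (fun n : ℕ ↦ ∑' k : ℕ, (-t) ^ k *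
      ((n : ℝ) ^ (1 - (ρ * k + ρ)) * Ring.multichoose (ρ * k + ρ) n))
      atTop (𝓝 (∑' k : ℕ, (-t) ^ k / Real.Gamma (ρ * k + ρ))) := by
    refine tendsto_tsum_of_dominated_convergence
      (bound := fun k : ℕ ↦ Real.exp (2 * m) * (2 * t)⁻¹ * (ρ * (k * (1 / 2) ^ k + (1 / 2) ^ k)))
      ?_ (fun k ↦ (tendsto_rpow_mul_multichoose (by positivity)).const_mul _) ?_
    · refine ((Summable.add ?_ summable_geometric_two).mul_left _).mul_left _
      simpa using summable_pow_mul_geometric_of_norm_lt_one (R := ℝ) 1 (r := 1 / 2) (by norm_num)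
    · filter_upwards [eventually_gt_atTop 0,
        tendsto_natCast_atTop_atTop.eventually_ge_atTop (2 * m)] with n hn hnm k
      have hn' : (0 : ℝ) < n := by exact_mod_cast hn
      have ha : 0 ≤ ρ * k + ρ := by positivity
      have hy0 : 0 < m / n := by positivity
      have hy1 : m / n ≤ 1 / 2 := by rw [div_le_div_iff₀ hn' two_pos]; linarith
      have h := natCast_mul_multichoose_mul_pow_le ha (r := 1 - m / n)
        (by linarith) (by linarith) n
      rw [sub_sub_cancel, Real.div_rpow hm0.le hn'.le, rpow_neg_mul_natCast_add hm0, hmρ] at h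
      have hexp : 1 ≤ Real.exp (2 * m) * (1 - m / n) ^ n := by
        have h1 : 1 ≤ Real.exp (2 * (m / n)) * (1 - m / n) := by
          nlinarith [Real.add_one_le_exp (2 * (m / n))]
        have h2 : Real.exp (2 * m) = Real.exp (2 * (m / n)) ^ n := by
          rw [← Real.exp_nat_mul]; congr 1; field_simp
        rw [h2, ← mul_pow]
        exact one_le_pow₀ h1
      have hM := multichoose_nonneg ha n
      have hna : (0 : ℝ) < (n : ℝ) ^ (-(ρ * k + ρ)) := by positivity
      rw [norm_mul, norm_pow, norm_neg, Real.norm_of_nonneg ht.le,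
        Real.norm_of_nonneg (by positivity), sub_eq_add_neg, Real.rpow_add hn', Real.rpow_one]
      set N := (n : ℝ) ^ (-(ρ * k + ρ)) with hN
      set M := Ring.multichoose (ρ * k + ρ) n
      calc t ^ k * (n * N * M) ≤ t ^ k * (n * N * M) * (Real.exp (2 * m) * (1 - m / n) ^ n) :=
            le_mul_of_one_le_right (by positivity) hexp
        _ = t ^ k * N * Real.exp (2 * m) * (n * M * (1 - m / n) ^ n) := by ring
        _ ≤ t ^ k * N * Real.exp (2 * m) *
              ((ρ * k + ρ) * (((2 * t) ^ (k + 1))⁻¹ / N)) := by gcongr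
        _ = _ := by
          rw [one_div, inv_pow, mul_pow]
          field_simp
          ring
  refine key.congr' ?_
  filter_upwards [eventually_gt_atTop 0] with n hn
  have hn' : (0 : ℝ) < n := by exact_mod_cast hn
  rw [resolventSeries, coeff_mk, ← tsum_mul_left]
  congr 1 with k
  have : (n : ℝ) ^ (1 - (ρ * k + ρ)) = (n : ℝ) ^ (1 - ρ) * ((n : ℝ) ^ (-ρ)) ^ k := by
    rw [← Real.rpow_mul_natCast hn'.le, ← Real.rpow_add hn']
    ring_nf
  rw [this, ← neg_mul, mul_pow]
  ring

/-- For every `ρ ∈ (0, 1)` there exists a constant `C > 0` such that for all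
`t > 0`, `|E_{ρ,ρ}(−t)| ≤ C/(1 + t)`, where `E_{ρ,μ}(z) = ∑_{k=0}^∞ z^k / Γ(ρk + μ)`. -/
theorem mittagLeffler_decay (ρ : ℝ) (hρ0 : 0 < ρ) (hρ1 : ρ < 1) :
    ∃ C > 0, ∀ t > 0, |∑' k : ℕ, (-t) ^ k / Real.Gamma (ρ * k + ρ)| ≤ C / (1 + t) := by
  have hΓ := Real.Gamma_pos_of_pos hρ0
  refine ⟨(Real.Gamma ρ)⁻¹ + ρ, by positivity, fun t ht ↦ ?_⟩
  have hlim := tendsto_rpow_mul_coeff_resolventSeries hρ0 ht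
  have hres : ∀ᶠ n : ℕ in atTop, (multichooseSeries (-ρ) + PowerSeries.C (t * (n : ℝ) ^ (-ρ))) *
      resolventSeries ρ (t * (n : ℝ) ^ (-ρ)) = 1 := by
    have h : Tendsto (fun n : ℕ ↦ 2 * (t * (n : ℝ) ^ (-ρ))) atTop (𝓝 0) := by
      simpa using (((tendsto_rpow_neg_atTop hρ0).comp
        tendsto_natCast_atTop_atTop).const_mul t).const_mul 2
    filter_upwards [eventually_gt_atTop 0, h.eventually_lt_const one_pos] with n hn h1
    exact mul_resolventSeries hρ0 (by positivity) h1
  set E := ∑' k : ℕ, (-t) ^ k / Real.Gamma (ρ * k + ρ)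
  have h0 : 0 ≤ E := by
    refine ge_of_tendsto hlim ?_
    filter_upwards [hres] with n hn
    exact mul_nonneg (by positivity) (resolvent_coeff_nonneg hρ0.le hρ1.le (by positivity) hn n)
  have h1 : E ≤ (Real.Gamma ρ)⁻¹ := by
    refine le_of_tendsto_of_tendsto hlim (tendsto_rpow_mul_multichoose hρ0) ?_
    filter_upwards [hres] with n hn
    exact mul_le_mul_of_nonneg_left
      (resolvent_coeff_le hρ0.le hρ1.le (by positivity) hn n) (by positivity)
  have h2 : t * E ≤ ρ := by
    refine le_of_tendsto (hlim.const_mul t) ?_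
    filter_upwards [hres, eventually_gt_atTop 0] with n hn hn0
    have hn' : (0 : ℝ) < n := by exact_mod_cast hn0
    refine le_trans (le_of_eq ?_)
      (mul_resolvent_coeff_le hρ0.le hρ1.le (by positivity) hn n)
    rw [sub_eq_add_neg, Real.rpow_add hn', Real.rpow_one]
    ring
  rw [abs_of_nonneg h0, le_div_iff₀ (by positivity)]
  linarith
end

section
/- Let t₀ ≥ 1 be a real number. Then the function g(ρ) = t₀^{ρ−1} / Γ(ρ) is strictly increasing on the interval (0, 1]. -/
/-- Let `t₀ ≥ 1`. Then the function `g(ρ) = t₀^{ρ−1} / Γ(ρ)` is strictly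
increasing on the interval `(0, 1]`. -/
theorem strictMonoOn_rpow_div_Gamma (t₀ : ℝ) (ht₀ : 1 ≤ t₀) :
    StrictMonoOn (fun ρ : ℝ => t₀ ^ (ρ - 1) / Real.Gamma ρ) (Set.Ioc 0 1) := by
  intro a ha b hb hab
  exact div_lt_div₀' (Real.rpow_le_rpow_of_exponent_le ht₀ (by linarith))
    (Real.Gamma_strictAntiOn_Ioc ha hb hab) (Real.rpow_pos_of_pos (by linarith) _)
    (Real.Gamma_pos_of_pos hb.1)
end

section
/- Let t₀ ≥ 1 and φ₁ ≠ 0 be real numbers, and define f(ρ) = φ₁ t₀^{ρ−1} / Γ(ρ) for ρ ∈ (0, 1]. Then: (i) if φ₁ > 0 then f is strictly increasing on (0, 1], and if φ₁ < 0 then f is strictly decreasing on (0, 1]; (ii) lim_{ρ → 0+} f(ρ) = 0; and (iii) f(1) = φ₁. -/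
open Filter Topology

/-- For a base at least `1`, the quotient `t ^ (x - 1) / Γ(x)` is strictly increasing
on `(0, 1]`. -/
theorem strictMonoOn_rpow_sub_one_div_Gamma {t : ℝ} (ht : 1 ≤ t) :
    StrictMonoOn (fun x : ℝ => t ^ (x - 1) / Real.Gamma x) (Set.Ioc 0 1) := by
  intro a ha b hb hab
  have ht0 : 0 < t := zero_lt_one.trans_le ht
  exact div_lt_div₀' (Real.rpow_le_rpow_of_exponent_le ht (by linarith))
    (Real.Gamma_strictAntiOn_Ioc ha hb hab) (Real.rpow_pos_of_pos ht0 _)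
    (Real.Gamma_pos_of_pos hb.1)

/-- For a positive base, `t ^ (x - 1) / Γ(x)` tends to `0` as `x` tends to `0`. -/
theorem tendsto_rpow_sub_one_div_Gamma_zero {t : ℝ} (ht : 0 < t) :
    Tendsto (fun x : ℝ => t ^ (x - 1) / Real.Gamma x) (𝓝[≠] 0) (𝓝 0) := by
  have hG : ContinuousAt (fun x : ℝ => Real.Gamma (x + 1)) 0 := by
    refine ContinuousAt.comp (g := Real.Gamma) ?_ (by fun_prop)
    refine (Real.differentiableAt_Gamma fun m => ?_).continuousAt
    have : (0 : ℝ) ≤ m := m.cast_nonneg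
    linarith
  have hp : ContinuousAt (fun x : ℝ => t ^ (x - 1)) 0 :=
    ContinuousAt.rpow (by fun_prop) (by fun_prop) (Or.inl ht.ne')
  have h : Tendsto (fun x : ℝ => x * t ^ (x - 1) / Real.Gamma (x + 1)) (𝓝 0) (𝓝 0) := by
    have hc : ContinuousAt (fun x : ℝ => x * t ^ (x - 1) / Real.Gamma (x + 1)) 0 :=
      (continuousAt_id.mul hp).div hG (by simp)
    simpa using hc.tendsto
  refine (h.mono_left nhdsWithin_le_nhds).congr' ?_
  filter_upwards [self_mem_nhdsWithin] with x hx
  rw [Real.Gamma_add_one hx, mul_div_mul_left _ _ hx]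

/-- **Lemma 4.1 of the paper.** Let `t₀ ≥ 1` and `φ₁ ≠ 0`, and define
`f(ρ) = φ₁ t₀^{ρ−1} / Γ(ρ)` for `ρ ∈ (0, 1]`. Then:
(i) if `φ₁ > 0` then `f` is strictly increasing on `(0, 1]`, and if `φ₁ < 0` then `f` is
strictly decreasing on `(0, 1]`; (ii) `lim_{ρ→0+} f(ρ) = 0`; (iii) `f(1) = φ₁`. -/
theorem observation_function_monotone (t₀ φ₁ : ℝ) (ht₀ : 1 ≤ t₀) (hφ₁ : φ₁ ≠ 0) :
    (0 < φ₁ → StrictMonoOn (fun ρ : ℝ => φ₁ * (t₀ ^ (ρ - 1) / Real.Gamma ρ)) (Set.Ioc 0 1)) ∧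
    (φ₁ < 0 → StrictAntiOn (fun ρ : ℝ => φ₁ * (t₀ ^ (ρ - 1) / Real.Gamma ρ)) (Set.Ioc 0 1)) ∧
    Tendsto (fun ρ : ℝ => φ₁ * (t₀ ^ (ρ - 1) / Real.Gamma ρ)) (𝓝[>] 0) (𝓝 0) ∧
    φ₁ * (t₀ ^ ((1 : ℝ) - 1) / Real.Gamma 1) = φ₁ := by
  have hmono := strictMonoOn_rpow_sub_one_div_Gamma ht₀
  refine ⟨fun h a ha b hb hab => mul_lt_mul_of_pos_left (hmono ha hb hab) h,
    fun h a ha b hb hab => mul_lt_mul_of_neg_left (hmono ha hb hab) h, ?_, by simp⟩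
  have hlim := tendsto_rpow_sub_one_div_Gamma_zero (zero_lt_one.trans_le ht₀)
  simpa using (hlim.mono_left (nhdsGT_le_nhdsNE 0)).const_mul φ₁
end

section
/- Let 0 < ρ < 1 and λ ≥ 0 be real numbers. Then for every t > 0, (1/Γ(1−ρ)) ∫₀^t ξ^{ρ−1} E_{ρ,ρ}(−λ ξ^ρ) (t−ξ)^{−ρ} dξ = E_{ρ,1}(−λ t^ρ), where E_{ρ,μ}(z) = Σ_{k=0}^∞ z^k / Γ(ρk + μ). -/
/-- The Euler beta integral over `[0, t]`, in real form. -/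
theorem integral_rpow_mul_sub_rpow {a b t : ℝ} (ha : 0 < a) (hb : 0 < b) (ht : 0 < t) :
    ∫ x in (0 : ℝ)..t, x ^ (a - 1) * (t - x) ^ (b - 1) =
      t ^ (a + b - 1) * (Real.Gamma a * Real.Gamma b / Real.Gamma (a + b)) := by
  have h := Complex.betaIntegral_scaled a b ht
  rw [Complex.betaIntegral_eq_Gamma_mul_div _ _ (by simpa) (by simpa)] at h
  apply Complex.ofReal_injective
  rw [← intervalIntegral.integral_ofReal]
  push_cast
  rw [Complex.ofReal_cpow ht.le, ← Complex.Gamma_ofReal, ← Complex.Gamma_ofReal,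
    ← Complex.Gamma_ofReal]
  push_cast
  rw [← h]
  refine intervalIntegral.integral_congr fun x hx => ?_
  rw [Set.uIcc_of_le ht.le] at hx
  rw [Complex.ofReal_cpow hx.1, Complex.ofReal_cpow (sub_nonneg.2 hx.2)]
  push_cast
  rfl

open MeasureTheory in
theorem integrableOn_rpow_mul_sub_rpow {a b t : ℝ} (ha : 0 < a) (hb : 0 < b) (ht : 0 < t) :
    IntegrableOn (fun x : ℝ => x ^ (a - 1) * (t - x) ^ (b - 1)) (Set.Ioc 0 t) := by
  rw [← intervalIntegrable_iff_integrableOn_Ioc_of_le ht.le]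
  apply intervalIntegral.intervalIntegrable_of_integral_ne_zero
  rw [integral_rpow_mul_sub_rpow ha hb ht]
  have h1 := Real.Gamma_pos_of_pos ha
  have h2 := Real.Gamma_pos_of_pos hb
  have h3 := Real.Gamma_pos_of_pos (add_pos ha hb)
  positivity

/-- A lower bound for the growth of `Γ`, from its log-convexity. -/
theorem rpow_mul_Gamma_le_Gamma_add {x r : ℝ} (hr0 : 0 < r) (hr1 : r < 1) (hx : 0 < x + r - 1) :
    (x + r - 1) ^ r * Real.Gamma x ≤ Real.Gamma (x + r) := by
  have h := Real.Gamma_mul_add_mul_le_rpow_Gamma_mul_rpow_Gamma hx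
    (show 0 < x + r by linarith) hr0 (show 0 < 1 - r by linarith) (by ring)
  rw [show r * (x + r - 1) + (1 - r) * (x + r) = x by ring] at h
  have hG := Real.Gamma_pos_of_pos hx
  have e : Real.Gamma (x + r) = (x + r - 1) * Real.Gamma (x + r - 1) := by
    rw [← Real.Gamma_add_one hx.ne']; congr 1; ring
  have hG' : 0 < Real.Gamma (x + r) := Real.Gamma_pos_of_pos (by linarith)
  calc (x + r - 1) ^ r * Real.Gamma x
      ≤ (x + r - 1) ^ r * (Real.Gamma (x + r - 1) ^ r * Real.Gamma (x + r) ^ (1 - r)) := by gcongr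
    _ = Real.Gamma (x + r) ^ r * Real.Gamma (x + r) ^ (1 - r) := by
      rw [← mul_assoc, ← Real.mul_rpow hx.le hG.le, ← e]
    _ = Real.Gamma (x + r) := by
      rw [← Real.rpow_add hG', add_sub_cancel, Real.rpow_one]

open Filter in
/-- The Mittag-Leffler series `E_{r,1}(z)` converges for `0 < r < 1`. -/
theorem summable_pow_div_Gamma {r : ℝ} (hr0 : 0 < r) (hr1 : r < 1) (z : ℝ) :
    Summable fun k : ℕ => z ^ k / Real.Gamma (r * k + 1) := by
  refine summable_of_ratio_norm_eventually_le (r := 1 / 2) (by norm_num) ?_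
  have hlim : Tendsto (fun k : ℕ => (r * (k + 1 : ℝ)) ^ r) atTop atTop :=
    (tendsto_rpow_atTop hr0).comp <| Tendsto.const_mul_atTop hr0 <|
      tendsto_atTop_add_const_right _ _ tendsto_natCast_atTop_atTop
  filter_upwards [hlim.eventually_ge_atTop (2 * |z|)] with k hk
  have hk0 : (0 : ℝ) ≤ k := k.cast_nonneg
  have hG : 0 < Real.Gamma (r * k + 1) := Real.Gamma_pos_of_pos (by positivity)
  have hG' : 0 < Real.Gamma (r * (k + 1 : ℕ) + 1) := Real.Gamma_pos_of_pos (by positivity)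
  have h := rpow_mul_Gamma_le_Gamma_add (x := r * k + 1) hr0 hr1
    (by have : 0 ≤ r * k := by positivity
        linarith)
  rw [show r * k + 1 + r - 1 = r * (k + 1 : ℝ) by ring,
    show r * k + 1 + r = r * (k + 1 : ℕ) + 1 by push_cast; ring] at h
  have h2 := (mul_le_mul_of_nonneg_right hk hG.le).trans h
  rw [norm_div, norm_div, norm_pow, norm_pow, Real.norm_eq_abs, Real.norm_of_nonneg hG.le,
    Real.norm_of_nonneg hG'.le, ← mul_div_assoc, div_le_div_iff₀ hG' hG, pow_succ]
  have := mul_le_mul_of_nonneg_left h2 (pow_nonneg (abs_nonneg z) k)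
  linarith

open MeasureTheory in
/-- Let `0 < ρ < 1` and `λ ≥ 0`. Then for every `t > 0`,
`(1/Γ(1−ρ)) ∫₀^t ξ^{ρ−1} E_{ρ,ρ}(−λ ξ^ρ) (t−ξ)^{−ρ} dξ = E_{ρ,1}(−λ t^ρ)`, where
`E_{ρ,μ}(z) = ∑_{k=0}^∞ z^k / Γ(ρk + μ)`. -/
theorem riemannLiouville_integral_of_mode (ρ l : ℝ) (hρ0 : 0 < ρ) (hρ1 : ρ < 1) (hl : 0 ≤ l) :
    ∀ t > (0 : ℝ),
      (1 / Real.Gamma (1 - ρ)) *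
          (∫ ξ in (0 : ℝ)..t,
            (ξ ^ (ρ - 1) * ∑' k : ℕ, (-l * ξ ^ ρ) ^ k / Real.Gamma (ρ * k + ρ)) *
              (t - ξ) ^ (-ρ)) =
        ∑' k : ℕ, (-l * t ^ ρ) ^ k / Real.Gamma (ρ * k + 1) := by
  intro t ht
  have hρ' : 0 < 1 - ρ := by linarith
  have hG1 := Real.Gamma_pos_of_pos hρ'
  have ha (k : ℕ) : 0 < ρ * k + ρ := by positivity
  have hGk (k : ℕ) := Real.Gamma_pos_of_pos (ha k)
  let B (k : ℕ) (ξ : ℝ) : ℝ := ξ ^ (ρ * k + ρ - 1) * (t - ξ) ^ (1 - ρ - 1)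
  let F (k : ℕ) (ξ : ℝ) : ℝ := (-l) ^ k / Real.Gamma (ρ * k + ρ) * B k ξ
  have hB (k : ℕ) : ∀ c : ℝ, ∫ ξ in Set.Ioc 0 t, c ^ k / Real.Gamma (ρ * k + ρ) * B k ξ =
      Real.Gamma (1 - ρ) * ((c * t ^ ρ) ^ k / Real.Gamma (ρ * k + 1)) := by
    intro c
    rw [integral_const_mul, ← intervalIntegral.integral_of_le ht.le,
      integral_rpow_mul_sub_rpow (ha k) hρ' ht, show ρ * k + ρ + (1 - ρ) - 1 = ρ * k by ring,
      show ρ * k + ρ + (1 - ρ) = ρ * k + 1 by ring, Real.rpow_mul ht.le, Real.rpow_natCast,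
      mul_pow]
    have := (hGk k).ne'
    field_simp
  have hint (k : ℕ) : Integrable (F k) (volume.restrict (Set.Ioc 0 t)) :=
    (integrableOn_rpow_mul_sub_rpow (ha k) hρ' ht).const_mul _
  have hnorm (k : ℕ) : ∫ ξ in Set.Ioc 0 t, ‖F k ξ‖ =
      Real.Gamma (1 - ρ) * ((|-l| * t ^ ρ) ^ k / Real.Gamma (ρ * k + 1)) := by
    rw [← hB k |-l|]
    refine setIntegral_congr_fun measurableSet_Ioc fun ξ hξ => ?_
    have h1 : 0 ≤ B k ξ :=
      mul_nonneg (Real.rpow_nonneg hξ.1.le _) (Real.rpow_nonneg (sub_nonneg.2 hξ.2) _)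
    simp only [F]
    rw [norm_mul, norm_div, norm_pow, Real.norm_eq_abs, Real.norm_of_nonneg (hGk k).le,
      Real.norm_of_nonneg h1]
  have hsum := integral_tsum_of_summable_integral_norm hint
    (by simp_rw [hnorm]; exact (summable_pow_div_Gamma hρ0 hρ1 _).mul_left _)
  have hF : ∫ ξ in (0 : ℝ)..t,
      (ξ ^ (ρ - 1) * ∑' k : ℕ, (-l * ξ ^ ρ) ^ k / Real.Gamma (ρ * k + ρ)) * (t - ξ) ^ (-ρ) =
      ∫ ξ in Set.Ioc 0 t, ∑' k, F k ξ := by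
    rw [intervalIntegral.integral_of_le ht.le]
    refine setIntegral_congr_fun measurableSet_Ioc fun ξ hξ => ?_
    rw [← tsum_mul_left, ← tsum_mul_right]
    refine tsum_congr fun k => ?_
    simp only [F, B]
    rw [show 1 - ρ - 1 = -ρ by ring, show ρ * k + ρ - 1 = ρ * k + (ρ - 1) by ring,
      Real.rpow_add hξ.1, Real.rpow_mul hξ.1.le, Real.rpow_natCast, mul_pow]
    ring
  rw [hF, ← hsum, ← tsum_mul_left]
  refine tsum_congr fun k => ?_
  rw [hB k (-l), ← mul_assoc, one_div_mul_cancel hG1.ne', one_mul]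
end

section
/- Let 0 < ρ < 1 and λ ≥ 0 be real numbers, and set T(t) = t^{ρ−1} E_{ρ,ρ}(−λ t^ρ) for t > 0. Then lim_{t→0+} (1/Γ(1−ρ)) ∫₀^t T(ξ) (t−ξ)^{−ρ} dξ = 1; that is, T satisfies the Cauchy-type initial condition lim_{t→0+} ∂_t^{ρ−1} T(t) = 1. -/
open Filter Topology

/-- The Gamma function is bounded below by a positive constant away from `0`. -/
theorem exists_pos_le_Gamma {a : ℝ} (ha : 0 < a) :
    ∃ c > 0, ∀ x ≥ a, c ≤ Real.Gamma x := by
  have hcont : ContinuousOn Real.Gamma (Set.Icc a (max a 2)) := fun x hx =>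
    (Real.differentiableAt_Gamma fun m => by
      have := hx.1
      have : (0 : ℝ) ≤ m := m.cast_nonneg
      linarith).continuousAt.continuousWithinAt
  obtain ⟨y, hy, hmin⟩ := isCompact_Icc.exists_isMinOn
    (Set.nonempty_Icc.2 (le_max_left a 2)) hcont
  refine ⟨Real.Gamma y, Real.Gamma_pos_of_pos (ha.trans_le hy.1), fun x hx => ?_⟩
  rcases le_total x (max a 2) with h | h
  · exact hmin ⟨hx, h⟩
  · exact (hmin (Set.right_mem_Icc.2 (le_max_left a 2))).trans
      (Real.Gamma_strictMonoOn_Ici.monotoneOn (le_max_right a 2)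
        ((le_max_right a 2).trans h) h)

/-- The two-parameter Mittag-Leffler function `E_{ρ,μ}` on the reals. -/
noncomputable def mittagLeffler (ρ μ z : ℝ) : ℝ :=
  ∑' k : ℕ, z ^ k / Real.Gamma (ρ * k + μ)

theorem mittagLeffler_zero (ρ μ : ℝ) : mittagLeffler ρ μ 0 = 1 / Real.Gamma μ := by
  rw [mittagLeffler, tsum_eq_single 0 fun k hk => by simp [hk]]
  simp

/-- The terms of the Mittag-Leffler series are dominated by a geometric series on `[-1/2, 1/2]`. -/
theorem exists_norm_mittagLeffler_term_le {ρ μ : ℝ} (hρ : 0 < ρ) (hμ : 0 < μ) :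
    ∃ C : ℝ, ∀ (k : ℕ), ∀ z ∈ Set.Icc (-(1 / 2)) (1 / 2 : ℝ),
      ‖z ^ k / Real.Gamma (ρ * k + μ)‖ ≤ C * (1 / 2 : ℝ) ^ k := by
  obtain ⟨c, hc, h⟩ := exists_pos_le_Gamma hμ
  refine ⟨c⁻¹, fun k z hz => ?_⟩
  have hk : c ≤ Real.Gamma (ρ * k + μ) := h _ (by
    have : 0 ≤ ρ * k := by positivity
    linarith)
  rw [norm_div, norm_pow, Real.norm_eq_abs, Real.norm_of_nonneg (hc.le.trans hk), div_eq_inv_mul]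
  have hz' : |z| ≤ 1 / 2 := abs_le.2 hz
  gcongr

theorem continuousOn_mittagLeffler {ρ μ : ℝ} (hρ : 0 < ρ) (hμ : 0 < μ) :
    ContinuousOn (mittagLeffler ρ μ) (Set.Icc (-(1 / 2)) (1 / 2)) := by
  obtain ⟨C, hC⟩ := exists_norm_mittagLeffler_term_le hρ hμ
  exact continuousOn_tsum (fun k => by fun_prop)
    ((summable_geometric_of_lt_one (by norm_num) (by norm_num)).mul_left C) hC

theorem intervalIntegrable_rpow_mul_one_sub_rpow {α β : ℝ} (hα : 0 < α) (hβ : 0 < β) :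
    IntervalIntegrable (fun s : ℝ => s ^ (α - 1) * (1 - s) ^ (β - 1))
      MeasureTheory.volume 0 1 := by
  have h := Complex.betaIntegral_convergent (u := α) (v := β) (by simpa) (by simpa)
  rw [intervalIntegrable_iff_integrableOn_Ioc_of_le zero_le_one] at h ⊢
  refine MeasureTheory.IntegrableOn.congr_fun h.re (fun s hs => ?_) measurableSet_Ioc
  have h0 := hs.1.le
  have h1 : 0 ≤ 1 - s := sub_nonneg.2 hs.2
  norm_cast
  rw [← Complex.ofReal_cpow h0, ← Complex.ofReal_cpow h1, RCLike.re_to_complex,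
    Complex.re_mul_ofReal, Complex.ofReal_re]

theorem integral_rpow_mul_one_sub_rpow {α β : ℝ} (hα : 0 < α) (hβ : 0 < β) :
    ∫ s in (0 : ℝ)..1, s ^ (α - 1) * (1 - s) ^ (β - 1) =
      Real.Gamma α * Real.Gamma β / Real.Gamma (α + β) := by
  have h := ProbabilityTheory.beta_eq_betaIntegralReal α β hα hβ
  rw [ProbabilityTheory.beta] at h
  rw [h, Complex.betaIntegral, ← Complex.ofReal_re (∫ s in (0 : ℝ)..1, _),
    ← intervalIntegral.integral_ofReal]
  congr 1
  refine intervalIntegral.integral_congr fun s hs => ?_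
  rw [Set.uIcc_of_le zero_le_one] at hs
  have h1 : 0 ≤ 1 - s := sub_nonneg.2 hs.2
  push_cast [Complex.ofReal_cpow hs.1, Complex.ofReal_cpow h1]
  rfl

/-- Rescaling a fractional integral of order `1 - ρ` to the unit interval. -/
theorem integral_rpow_mul_comp_mul_rpow (ρ : ℝ) (F : ℝ → ℝ) {t : ℝ} (ht : 0 < t) :
    ∫ ξ in (0 : ℝ)..t, ξ ^ (ρ - 1) * F ξ * (t - ξ) ^ (-ρ) =
      ∫ s in (0 : ℝ)..1, s ^ (ρ - 1) * (1 - s) ^ (-ρ) * F (t * s) := by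
  have h := intervalIntegral.mul_integral_comp_mul_left (a := 0) (b := 1)
    (f := fun ξ => ξ ^ (ρ - 1) * F ξ * (t - ξ) ^ (-ρ)) t
  rw [mul_zero, mul_one] at h
  rw [← h, ← intervalIntegral.integral_const_mul]
  refine intervalIntegral.integral_congr fun s hs => ?_
  rw [Set.uIcc_of_le zero_le_one] at hs
  have h1 : 0 ≤ 1 - s := sub_nonneg.2 hs.2
  have hpow : t * (t ^ (ρ - 1) * t ^ (-ρ)) = 1 := by
    rw [← Real.rpow_add ht, show ρ - 1 + -ρ = -1 by ring, Real.rpow_neg_one, mul_inv_cancel₀ ht.ne']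
  rw [show t - t * s = t * (1 - s) by ring, Real.mul_rpow ht.le hs.1, Real.mul_rpow ht.le h1]
  linear_combination (s ^ (ρ - 1) * (1 - s) ^ (-ρ) * F (t * s)) * hpow

/-- Let `0 < ρ < 1` and `λ ≥ 0`, and set
`T(t) = t^{ρ−1} E_{ρ,ρ}(−λ t^ρ)` for `t > 0`. Then
`lim_{t→0+} (1/Γ(1−ρ)) ∫₀^t T(ξ) (t−ξ)^{−ρ} dξ = 1`; that is, `T` satisfies the Cauchy-type
initial condition `lim_{t→0+} ∂_t^{ρ−1} T(t) = 1`. -/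
theorem mode_initial_condition (ρ l : ℝ) (hρ0 : 0 < ρ) (hρ1 : ρ < 1) (hl : 0 ≤ l)
    (T : ℝ → ℝ)
    (hT : ∀ t > (0 : ℝ), T t = t ^ (ρ - 1) * ∑' k : ℕ, (-l * t ^ ρ) ^ k / Real.Gamma (ρ * k + ρ)) :
    Tendsto (fun t : ℝ => (1 / Real.Gamma (1 - ρ)) * ∫ ξ in (0 : ℝ)..t, T ξ * (t - ξ) ^ (-ρ))
      (𝓝[>] 0) (𝓝 1) := by
  have hβ : 0 < 1 - ρ := sub_pos.2 hρ1
  set E := mittagLeffler ρ ρ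
  have hEc : ContinuousOn E (Set.Icc (-(1 / 2)) (1 / 2)) := continuousOn_mittagLeffler hρ0 hρ0
  obtain ⟨C, hC⟩ := isCompact_Icc.exists_bound_of_continuousOn hEc
  have hweight := intervalIntegrable_rpow_mul_one_sub_rpow hρ0 hβ
  have hbeta := integral_rpow_mul_one_sub_rpow hρ0 hβ
  rw [show 1 - ρ - 1 = -ρ by ring] at hweight hbeta
  rw [show ρ + (1 - ρ) = 1 by ring, Real.Gamma_one, div_one] at hbeta
  have hzero (s : ℝ) : Tendsto (fun t : ℝ => -l * (t * s) ^ ρ) (𝓝[>] 0) (𝓝 0) := by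
    have : Continuous fun t : ℝ => -l * (t * s) ^ ρ :=
      continuous_const.mul ((continuous_mul_const s).rpow_const fun _ => Or.inr hρ0.le)
    simpa [Real.zero_rpow hρ0.ne'] using (this.tendsto 0).mono_left nhdsWithin_le_nhds
  have hsmall : ∀ᶠ t : ℝ in 𝓝[>] 0, ∀ s ∈ Set.Ioc (0 : ℝ) 1,
      -l * (t * s) ^ ρ ∈ Set.Icc (-(1 / 2)) (1 / 2 : ℝ) := by
    filter_upwards [self_mem_nhdsWithin,
      (hzero 1).eventually (lt_mem_nhds (show -(1 / 2 : ℝ) < 0 by norm_num))] with t ht h s hs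
    have ht0 : (0 : ℝ) < t := ht
    have hts : 0 < t * s := mul_pos ht0 hs.1
    have hle : (t * s) ^ ρ ≤ (t * 1) ^ ρ := by
      have := hs.2
      gcongr
    have hmul := mul_le_mul_of_nonneg_left hle hl
    have hnonneg : 0 ≤ l * (t * s) ^ ρ := by positivity
    constructor <;> linarith
  have key : Tendsto (fun t : ℝ => ∫ s in (0 : ℝ)..1,
      s ^ (ρ - 1) * (1 - s) ^ (-ρ) * E (-l * (t * s) ^ ρ)) (𝓝[>] 0)
      (𝓝 (∫ s in (0 : ℝ)..1, s ^ (ρ - 1) * (1 - s) ^ (-ρ) * E 0)) := by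
    refine intervalIntegral.tendsto_integral_filter_of_dominated_convergence
      (fun s => s ^ (ρ - 1) * (1 - s) ^ (-ρ) * C) ?_ ?_ (hweight.mul_const C) ?_
    · filter_upwards [hsmall] with t ht
      rw [Set.uIoc_of_le zero_le_one]
      have hcomp : ContinuousOn (fun s => E (-l * (t * s) ^ ρ)) (Set.Ioc 0 1) :=
        hEc.comp (continuous_const.mul ((continuous_const_mul t).rpow_const
          fun _ => Or.inr hρ0.le)).continuousOn ht
      exact (Measurable.aestronglyMeasurable (by fun_prop)).mul
        (hcomp.aestronglyMeasurable measurableSet_Ioc)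
    · filter_upwards [hsmall] with t ht
      refine Eventually.of_forall fun s hs => ?_
      rw [Set.uIoc_of_le zero_le_one] at hs
      have h0 : 0 ≤ s := hs.1.le
      have h1 : 0 ≤ 1 - s := sub_nonneg.2 hs.2
      rw [norm_mul, Real.norm_of_nonneg (by positivity)]
      exact mul_le_mul_of_nonneg_left (hC _ (ht s hs)) (by positivity)
    · refine Eventually.of_forall fun s _ => Tendsto.const_mul _ ?_
      exact (hEc.continuousAt (Icc_mem_nhds (by norm_num) (by norm_num))).tendsto.comp (hzero s)
  rw [intervalIntegral.integral_mul_const, hbeta,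
    show E 0 = 1 / Real.Gamma ρ from mittagLeffler_zero ρ ρ] at key
  have hlim := key.const_mul (1 / Real.Gamma (1 - ρ))
  have hΓ := (Real.Gamma_pos_of_pos hρ0).ne'
  have hΓ' := (Real.Gamma_pos_of_pos hβ).ne'
  rw [show 1 / Real.Gamma (1 - ρ) * (Real.Gamma ρ * Real.Gamma (1 - ρ) * (1 / Real.Gamma ρ)) = 1 by
    field_simp] at hlim
  refine hlim.congr' ?_
  filter_upwards [self_mem_nhdsWithin] with t ht
  have ht0 : (0 : ℝ) < t := ht
  rw [← integral_rpow_mul_comp_mul_rpow ρ (fun ξ => E (-l * ξ ^ ρ)) ht0]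
  congr 1
  refine intervalIntegral.integral_congr_ae (Eventually.of_forall fun ξ hξ => ?_)
  rw [Set.uIoc_of_le ht0.le] at hξ
  rw [hT ξ hξ.1]
  rfl
end
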